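/- Assume two designated variables X_a and X_b among X_1,…,X_d satisfy the noisy-copy condition with parameter λ > 0. Let S̄ denote the maximal score over DAGs with in-degree at most k over the variables {X_1,…,X_d}∖{X_b}, and let β > 0. Assume that every DAG G' with in-degree at most k over {X_1,…,X_d}∖{X_b} in which X_a has at least one child satisfies score(G') ≤ S̄ − β. Then every G ∈ G_{d,k} in which X_a or X_b has at least one child other than X_a and X_b satisfies score(G) < S* − β + 3dλ. -/

import Mathlib

open Finset

/-- Shannon entropy (in nats) of a discrete random variable `X` on a finite
probability space with probability mass function `μ`. -/
noncomputable def ent {Ω γ : Type*} [Fintype Ω] [Fintype γ] [DecidableEq γ]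
    (μ : Ω → ℝ) (X : Ω → γ) : ℝ :=
  ∑ x : γ, Real.negMulLog (∑ ω : Ω, if X ω = x then μ ω else 0)

/-- Conditional Shannon entropy H(X ∣ Y), via the chain rule `H(X ∣ Y) = H(X,Y) - H(Y)`. -/
noncomputable def condEnt {Ω γ δ : Type*} [Fintype Ω] [Fintype γ] [Fintype δ]
    [DecidableEq γ] [DecidableEq δ] (μ : Ω → ℝ) (X : Ω → γ) (Y : Ω → δ) : ℝ :=
  ent μ (fun ω => (X ω, Y ω)) - ent μ Y

/-- `μ` is a probability mass function on the finite sample space `Ω`. -/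
def IsPMF {Ω : Type*} [Fintype Ω] (μ : Ω → ℝ) : Prop :=
  (∀ ω, 0 ≤ μ ω) ∧ ∑ ω : Ω, μ ω = 1

/-- The joint value of the tuple of variables `X j` for `j` in the finite set `P`. -/
def tupleOf {d : ℕ} {Ω α : Type*} (X : Fin d → Ω → α) (P : Finset (Fin d)) :
    Ω → ({j // j ∈ P} → α) :=
  fun ω j => X j.1 ω

/-- The entropy H(f) of the family `f = ⟨X_i, P⟩`: the conditional Shannon entropy of the
child variable `X i` given the joint value of its parents, the variables `X j` for `j ∈ P`. -/
noncomputable def famEnt {d : ℕ} {Ω α : Type*} [Fintype Ω] [Fintype α] [DecidableEq α]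
    (μ : Ω → ℝ) (X : Fin d → Ω → α) (i : Fin d) (P : Finset (Fin d)) : ℝ :=
  condEnt μ (X i) (tupleOf X P)

/-- A relation is acyclic if no (nonempty) directed path leads from a vertex to itself. -/
def Acyclic {V : Type*} (r : V → V → Prop) : Prop :=
  ∀ v, ¬ Relation.TransGen r v v

/-- A graph over the `d` variables, given as the assignment `g` of a parent set to each
child variable, is in `𝒢_{d,k}`: no variable is its own parent, every variable has at
most `k` parents, and the parent → child edge relation is acyclic. -/
def IsDAGdk {d : ℕ} (k : ℕ) (g : Fin d → Finset (Fin d)) : Prop :=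
  (∀ i, i ∉ g i ∧ (g i).card ≤ k) ∧ Acyclic (fun u w => u ∈ g w)

/-- The score of the graph `g`: minus the sum of the entropies of its families. -/
noncomputable def score {d : ℕ} {Ω α : Type*} [Fintype Ω] [Fintype α] [DecidableEq α]
    (μ : Ω → ℝ) (X : Fin d → Ω → α) (g : Fin d → Finset (Fin d)) : ℝ :=
  -∑ i : Fin d, famEnt μ X i (g i)

/-- `S* := max_{G ∈ 𝒢_{d,k}} score(G)`, the optimal score. -/
noncomputable def Sstar {d : ℕ} {Ω α : Type*} [Fintype Ω] [Fintype α] [DecidableEq α]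
    (k : ℕ) (μ : Ω → ℝ) (X : Fin d → Ω → α) : ℝ :=
  sSup {s | ∃ g, IsDAGdk k g ∧ score μ X g = s}

/-- `g` restricted to the variables of `W` is a DAG over the variables of `W` with
in-degree at most `k` (all parents of variables of `W` are themselves in `W`). -/
def IsDAGon {d : ℕ} (k : ℕ) (W : Finset (Fin d)) (g : Fin d → Finset (Fin d)) : Prop :=
  (∀ i ∈ W, i ∉ g i ∧ (g i).card ≤ k ∧ g i ⊆ W) ∧
  Acyclic (fun u w => w ∈ W ∧ u ∈ g w)

/-- `g` restricted to `W` is a legal family set for `W`: one family (with at most `k`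
parents, drawn from all the variables) for each variable of `W`, with no directed cycle. -/
def LegalFamSet {d : ℕ} (k : ℕ) (W : Finset (Fin d)) (g : Fin d → Finset (Fin d)) : Prop :=
  (∀ i ∈ W, i ∉ g i ∧ (g i).card ≤ k) ∧ Acyclic (fun u w => w ∈ W ∧ u ∈ g w)

/-- The score of the set of families of the variables of `W` in `g`. -/
noncomputable def scoreOn {d : ℕ} {Ω α : Type*} [Fintype Ω] [Fintype α] [DecidableEq α]
    (μ : Ω → ℝ) (X : Fin d → Ω → α) (W : Finset (Fin d)) (g : Fin d → Finset (Fin d)) : ℝ :=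
  -∑ i ∈ W, famEnt μ X i (g i)

/-- The maximal score over DAGs with in-degree at most `k` over the variables of `W`. -/
noncomputable def SstarOn {d : ℕ} {Ω α : Type*} [Fintype Ω] [Fintype α] [DecidableEq α]
    (k : ℕ) (W : Finset (Fin d)) (μ : Ω → ℝ) (X : Fin d → Ω → α) : ℝ :=
  sSup {s | ∃ g, IsDAGon k W g ∧ scoreOn μ X W g = s}

/-- `X b` is a noisy copy of `X a` with parameter `lam`: `X b` is conditionally
independent of every subset `S` of the remaining variables given `X a` (expressed by
`H(X_b ∣ X_a, S) = H(X_b ∣ X_a)`), and `max(H(X_b ∣ X_a), H(X_a ∣ X_b)) ≤ lam`. -/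
def NoisyCopy {d : ℕ} {Ω α : Type*} [Fintype Ω] [Fintype α] [DecidableEq α]
    (μ : Ω → ℝ) (X : Fin d → Ω → α) (a b : Fin d) (lam : ℝ) : Prop :=
  (∀ S : Finset (Fin d), a ∉ S → b ∉ S →
      condEnt μ (X b) (fun ω => (X a ω, tupleOf X S ω)) = condEnt μ (X b) (X a)) ∧
  condEnt μ (X b) (X a) ≤ lam ∧ condEnt μ (X a) (X b) ≤ lam

/-- Probability of the atom `X = x`. -/
noncomputable def prb {Ω γ : Type*} [Fintype Ω] [DecidableEq γ]
    (μ : Ω → ℝ) (X : Ω → γ) (x : γ) : ℝ := ∑ ω : Ω, if X ω = x then μ ω else 0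

lemma sum_mul_comp {Ω γ : Type*} [Fintype Ω] [Fintype γ] [DecidableEq γ]
    (μ : Ω → ℝ) (X : Ω → γ) (F : γ → ℝ) :
    ∑ ω, μ ω * F (X ω) = ∑ x, prb μ X x * F x := by
  simp only [prb, Finset.sum_mul]
  rw [Finset.sum_comm]
  refine Finset.sum_congr rfl fun ω _ => ?_
  simp [ite_mul]

lemma ent_eq {Ω γ : Type*} [Fintype Ω] [Fintype γ] [DecidableEq γ]
    (μ : Ω → ℝ) (X : Ω → γ) :
    ent μ X = -∑ ω, μ ω * Real.log (prb μ X (X ω)) := by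
  rw [sum_mul_comp μ X (fun x => Real.log (prb μ X x)), ← Finset.sum_neg_distrib]
  refine Finset.sum_congr rfl fun x _ => ?_
  simp [prb, Real.negMulLog]

lemma prb_nonneg {Ω γ : Type*} [Fintype Ω] [DecidableEq γ]
    {μ : Ω → ℝ} (hμ : IsPMF μ) (X : Ω → γ) (x : γ) : 0 ≤ prb μ X x :=
  Finset.sum_nonneg fun ω _ => by split_ifs <;> simp [hμ.1 ω]

lemma le_prb {Ω γ : Type*} [Fintype Ω] [DecidableEq γ]
    {μ : Ω → ℝ} (hμ : IsPMF μ) (X : Ω → γ) (ω : Ω) : μ ω ≤ prb μ X (X ω) := by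
  have := Finset.single_le_sum (f := fun ω' => if X ω' = X ω then μ ω' else 0)
    (fun ω' _ => by split_ifs <;> simp [hμ.1 ω']) (Finset.mem_univ ω)
  simpa [prb] using this

lemma ent_mono {Ω γ δ : Type*} [Fintype Ω] [Fintype γ] [DecidableEq γ]
    [Fintype δ] [DecidableEq δ] {μ : Ω → ℝ} (hμ : IsPMF μ) (X : Ω → γ) (Y : Ω → δ)
    (h : ∀ ω ω', X ω = X ω' → Y ω = Y ω') : ent μ Y ≤ ent μ X := by
  rw [ent_eq, ent_eq, neg_le_neg_iff]
  refine Finset.sum_le_sum fun ω _ => ?_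
  rcases (hμ.1 ω).eq_or_lt with h0 | h0
  · simp [← h0]
  refine mul_le_mul_of_nonneg_left (Real.log_le_log (h0.trans_le (le_prb hμ X ω)) ?_) h0.le
  refine Finset.sum_le_sum fun ω' _ => ?_
  by_cases hx : X ω' = X ω
  · simp [hx, h _ _ hx]
  · simp only [hx, if_false]; split_ifs <;> simp [hμ.1 ω']

lemma ent_congr {Ω γ δ : Type*} [Fintype Ω] [Fintype γ] [DecidableEq γ]
    [Fintype δ] [DecidableEq δ] {μ : Ω → ℝ} (hμ : IsPMF μ) (X : Ω → γ) (Y : Ω → δ)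
    (h : ∀ ω ω', X ω = X ω' ↔ Y ω = Y ω') : ent μ X = ent μ Y :=
  le_antisymm (ent_mono hμ _ _ fun _ _ => (h _ _).2) (ent_mono hμ _ _ fun _ _ => (h _ _).1)

lemma sum_prb_left {Ω γ δ : Type*} [Fintype Ω] [Fintype γ] [DecidableEq γ] [DecidableEq δ]
    (μ : Ω → ℝ) (X : Ω → γ) (Y : Ω → δ) (y : δ) :
    ∑ x, prb μ (fun ω => (X ω, Y ω)) (x, y) = prb μ Y y := by
  simp only [prb]
  rw [Finset.sum_comm]
  refine Finset.sum_congr rfl fun ω _ => ?_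
  simp [Prod.ext_iff, ite_and]

lemma sum_prb {Ω γ : Type*} [Fintype Ω] [Fintype γ] [DecidableEq γ]
    {μ : Ω → ℝ} (hμ : IsPMF μ) (X : Ω → γ) : ∑ x, prb μ X x = 1 := by
  have := sum_mul_comp μ X (fun _ => 1)
  simp only [mul_one] at this
  rw [← this, hμ.2]

lemma ent_submod {Ω γ δ ε : Type*} [Fintype Ω] [Fintype γ] [DecidableEq γ]
    [Fintype δ] [DecidableEq δ] [Fintype ε] [DecidableEq ε]
    {μ : Ω → ℝ} (hμ : IsPMF μ) (X : Ω → γ) (Z : Ω → δ) (Y : Ω → ε) :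
    ent μ (fun ω => (X ω, Z ω, Y ω)) + ent μ Y
      ≤ ent μ (fun ω => (X ω, Y ω)) + ent μ (fun ω => (Z ω, Y ω)) := by
  set A := prb μ (fun ω => (X ω, Z ω, Y ω)) with hA
  set B := prb μ Y with hB
  set C := prb μ (fun ω => (X ω, Y ω)) with hC
  set D := prb μ (fun ω => (Z ω, Y ω)) with hD
  have key : ∑ ω, μ ω * (C (X ω, Y ω) * D (Z ω, Y ω) / (A (X ω, Z ω, Y ω) * B (Y ω))) ≤ 1 := by
    have h1 := sum_mul_comp μ (fun ω => (X ω, Z ω, Y ω))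
      (fun p => C (p.1, p.2.2) * D (p.2.1, p.2.2) / (A p * B p.2.2))
    dsimp only at h1
    rw [h1]
    calc _ ≤ ∑ p : γ × δ × ε, C (p.1, p.2.2) * D (p.2.1, p.2.2) / B p.2.2 := by
          refine Finset.sum_le_sum fun p _ => ?_
          have hc : 0 ≤ C (p.1, p.2.2) * D (p.2.1, p.2.2) / B p.2.2 :=
            div_nonneg (mul_nonneg (prb_nonneg hμ _ _) (prb_nonneg hμ _ _)) (prb_nonneg hμ _ _)
          change A p * _ ≤ _
          by_cases h0 : A p = 0
          · rw [h0, zero_mul]; exact hc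
          · apply le_of_eq
            rw [mul_comm (A p) (B _), ← div_div, mul_div_cancel₀ _ h0]
      _ = ∑ y, ∑ x, ∑ z, C (x, y) * D (z, y) / B y := by
          simp_rw [Fintype.sum_prod_type]
          have e : ∀ x : γ, ∑ z : δ, ∑ y : ε, C (x, y) * D (z, y) / B y =
              ∑ y : ε, ∑ z : δ, C (x, y) * D (z, y) / B y := fun x => Finset.sum_comm
          simp_rw [e]
          exact Finset.sum_comm
      _ = ∑ y, B y := by
          refine Finset.sum_congr rfl fun y _ => ?_
          simp_rw [← Finset.sum_div, ← Finset.mul_sum, ← Finset.sum_mul]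
          rw [hC, hD, sum_prb_left, sum_prb_left]
          change B y * B y / B y = B y
          exact mul_self_div_self _
      _ = 1 := sum_prb hμ Y
      _ ≤ 1 := le_rfl
  have pt : ∀ ω, μ ω * (1 - C (X ω, Y ω) * D (Z ω, Y ω) / (A (X ω, Z ω, Y ω) * B (Y ω))) ≤
      μ ω * (Real.log (A (X ω, Z ω, Y ω)) + Real.log (B (Y ω)) - Real.log (C (X ω, Y ω))
        - Real.log (D (Z ω, Y ω))) := by
    intro ω
    rcases (hμ.1 ω).eq_or_lt with h0 | h0
    · simp [← h0]
    refine mul_le_mul_of_nonneg_left ?_ h0.le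
    have a1 : 0 < A (X ω, Z ω, Y ω) := h0.trans_le (le_prb hμ (fun ω => (X ω, Z ω, Y ω)) ω)
    have a2 : 0 < B (Y ω) := h0.trans_le (le_prb hμ Y ω)
    have a3 : 0 < C (X ω, Y ω) := h0.trans_le (le_prb hμ (fun ω => (X ω, Y ω)) ω)
    have a4 : 0 < D (Z ω, Y ω) := h0.trans_le (le_prb hμ (fun ω => (Z ω, Y ω)) ω)
    have := Real.log_le_sub_one_of_pos (div_pos (mul_pos a3 a4) (mul_pos a1 a2))
    rw [Real.log_div (mul_pos a3 a4).ne' (mul_pos a1 a2).ne', Real.log_mul a3.ne' a4.ne',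
      Real.log_mul a1.ne' a2.ne'] at this
    linarith
  have hs := Finset.sum_le_sum fun ω (_ : ω ∈ (Finset.univ : Finset Ω)) => pt ω
  simp only [mul_sub, mul_add, Finset.sum_sub_distrib, Finset.sum_add_distrib, mul_one, hμ.2] at hs
  simp only [ent_eq]
  change -∑ ω, μ ω * Real.log (A (X ω, Z ω, Y ω)) + -∑ ω, μ ω * Real.log (B (Y ω)) ≤
    -∑ ω, μ ω * Real.log (C (X ω, Y ω)) + -∑ ω, μ ω * Real.log (D (Z ω, Y ω))
  linarith

section tuples
variable {d : ℕ} {Ω α : Type*} [Fintype Ω] [Fintype α] [DecidableEq α]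

lemma tupleOf_eq_iff (X : Fin d → Ω → α) (S : Finset (Fin d)) (ω ω' : Ω) :
    tupleOf X S ω = tupleOf X S ω' ↔ ∀ j ∈ S, X j ω = X j ω' := by
  simp [funext_iff, tupleOf]

/-- Joint entropy of a set of variables. -/
noncomputable def hS (μ : Ω → ℝ) (X : Fin d → Ω → α) (S : Finset (Fin d)) : ℝ :=
  ent μ (tupleOf X S)

lemma hS_mono {μ : Ω → ℝ} (hμ : IsPMF μ) (X : Fin d → Ω → α) {S T : Finset (Fin d)}
    (h : S ⊆ T) : hS μ X S ≤ hS μ X T :=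
  ent_mono hμ _ _ fun ω ω' => by
    simp only [tupleOf_eq_iff]
    exact fun H j hj => H j (h hj)

lemma hS_submod {μ : Ω → ℝ} (hμ : IsPMF μ) (X : Fin d → Ω → α) (S T U : Finset (Fin d)) :
    hS μ X (S ∪ T ∪ U) + hS μ X U ≤ hS μ X (S ∪ U) + hS μ X (T ∪ U) := by
  have := ent_submod hμ (tupleOf X S) (tupleOf X T) (tupleOf X U)
  have e1 : hS μ X (S ∪ T ∪ U) = ent μ (fun ω => (tupleOf X S ω, tupleOf X T ω, tupleOf X U ω)) :=
    ent_congr hμ _ _ fun ω ω' => by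
      simp only [Prod.ext_iff, tupleOf_eq_iff, Finset.mem_union]; grind
  have e2 : hS μ X (S ∪ U) = ent μ (fun ω => (tupleOf X S ω, tupleOf X U ω)) :=
    ent_congr hμ _ _ fun ω ω' => by
      simp only [Prod.ext_iff, tupleOf_eq_iff, Finset.mem_union]; grind
  have e3 : hS μ X (T ∪ U) = ent μ (fun ω => (tupleOf X T ω, tupleOf X U ω)) :=
    ent_congr hμ _ _ fun ω ω' => by
      simp only [Prod.ext_iff, tupleOf_eq_iff, Finset.mem_union]; grind
  rw [e1, e2, e3]; exact this

lemma famEnt_eq {μ : Ω → ℝ} (hμ : IsPMF μ) (X : Fin d → Ω → α) (i : Fin d)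
    (P : Finset (Fin d)) : famEnt μ X i P = hS μ X (insert i P) - hS μ X P := by
  have : ent μ (fun ω => (X i ω, tupleOf X P ω)) = hS μ X (insert i P) :=
    ent_congr hμ _ _ fun ω ω' => by
      simp only [Prod.ext_iff, tupleOf_eq_iff, Finset.mem_insert]; grind
  rw [famEnt, condEnt, this]; rfl

lemma condEnt_eq {μ : Ω → ℝ} (hμ : IsPMF μ) (X : Fin d → Ω → α) (i j : Fin d) :
    condEnt μ (X i) (X j) = famEnt μ X i {j} := by
  rw [famEnt, condEnt, condEnt]
  congr 1
  · exact ent_congr hμ _ _ fun ω ω' => by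
      simp only [Prod.ext_iff, tupleOf_eq_iff, Finset.mem_singleton]; grind
  · exact ent_congr hμ _ _ fun ω ω' => by
      simp only [tupleOf_eq_iff, Finset.mem_singleton]; grind

lemma famEnt_nonneg {μ : Ω → ℝ} (hμ : IsPMF μ) (X : Fin d → Ω → α) (i : Fin d)
    (P : Finset (Fin d)) : 0 ≤ famEnt μ X i P := by
  rw [famEnt_eq hμ]
  linarith [hS_mono hμ X (Finset.subset_insert i P)]

lemma famEnt_anti {μ : Ω → ℝ} (hμ : IsPMF μ) (X : Fin d → Ω → α) (i : Fin d)
    {P Q : Finset (Fin d)} (h : P ⊆ Q) : famEnt μ X i Q ≤ famEnt μ X i P := by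
  rw [famEnt_eq hμ, famEnt_eq hμ]
  have := hS_submod hμ X {i} Q P
  rw [show {i} ∪ Q ∪ P = insert i Q by grind, show {i} ∪ P = insert i P by grind,
    show Q ∪ P = Q by grind] at this
  linarith

/-- Replacing the parent `b` by `a`. -/
lemma famEnt_replace {μ : Ω → ℝ} (hμ : IsPMF μ) (X : Fin d → Ω → α) (i a b : Fin d) {lam : ℝ}
    (hl : famEnt μ X b {a} ≤ lam) (P : Finset (Fin d)) (hb : b ∈ P) (hab : a ≠ b) :
    famEnt μ X i (insert a (P.erase b)) ≤ famEnt μ X i P + lam := by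
  have h1 : famEnt μ X b (insert a (P.erase b)) ≤ famEnt μ X b {a} :=
    famEnt_anti hμ X b (by grind)
  have h2 : famEnt μ X i (insert a P) ≤ famEnt μ X i P := famEnt_anti hμ X i (by grind)
  have h3 := hS_mono hμ X (show insert i (insert a (P.erase b)) ⊆ insert i (insert a P) by grind)
  rw [famEnt_eq hμ X b (insert a (P.erase b)),
    show insert b (insert a (P.erase b)) = insert a P by grind] at h1
  rw [famEnt_eq hμ X i (insert a P)] at h2
  rw [famEnt_eq hμ X i (insert a (P.erase b))]
  linarith

/-- Replacing the child `b` by `a`. -/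
lemma famEnt_child {μ : Ω → ℝ} (hμ : IsPMF μ) (X : Fin d → Ω → α) (a b : Fin d) {lam : ℝ}
    (hl : famEnt μ X a {b} ≤ lam) (P : Finset (Fin d)) :
    famEnt μ X a P ≤ famEnt μ X b P + lam := by
  have h1 : famEnt μ X a (insert b P) ≤ famEnt μ X a {b} := famEnt_anti hμ X a (by grind)
  have h3 := hS_mono hμ X (show insert a P ⊆ insert a (insert b P) by grind)
  rw [famEnt_eq hμ X a (insert b P)] at h1
  rw [famEnt_eq hμ X a P, famEnt_eq hμ X b P]
  linarith

end tuples

lemma acyclic_of_rank {V : Type*} {r : V → V → Prop} (f : V → ℕ)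
    (hf : ∀ u w, r u w → f u < f w) : Acyclic r := by
  intro v hv
  have : ∀ u w, Relation.TransGen r u w → f u < f w := by
    intro u w h
    induction h with
    | single h => exact hf _ _ h
    | tail _ h ih => exact ih.trans (hf _ _ h)
  exact lt_irrefl _ (this _ _ hv)

lemma exists_rank {V : Type*} [Fintype V] {r : V → V → Prop} (h : Acyclic r) :
    ∃ f : V → ℕ, ∀ u w, r u w → f u < f w := by
  classical
  refine ⟨fun v => (Finset.univ.filter fun u => Relation.TransGen r u v).card, fun u w huw => ?_⟩
  refine Finset.card_lt_card ⟨fun x hx => ?_, fun hsub => ?_⟩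
  · simp only [Finset.mem_filter, Finset.mem_univ, true_and] at hx ⊢
    exact hx.tail huw
  · have : u ∈ Finset.univ.filter fun x => Relation.TransGen r x u :=
      hsub (by simpa using Relation.TransGen.single huw)
    simp only [Finset.mem_filter, Finset.mem_univ, true_and] at this
    exact h u this

lemma SstarOn_le {d k : ℕ} {Ω α : Type*} [Fintype Ω] [Fintype α] [DecidableEq α]
    (hk : 1 ≤ k) (μ : Ω → ℝ) (X : Fin d → Ω → α) (lam : ℝ)
    (a b : Fin d) (hab : a ≠ b) (hl : famEnt μ X b {a} ≤ lam) :
    SstarOn k (Finset.univ.erase b) μ X ≤ Sstar k μ X + lam := by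
  refine csSup_le ⟨_, fun _ => ∅, ⟨by simp, acyclic_of_rank (fun _ => 0) (by simp)⟩, rfl⟩ ?_
  rintro s ⟨g, ⟨hg1, hg2⟩, rfl⟩
  obtain ⟨r, hr⟩ := exists_rank hg2
  set g' := Function.update g b {a} with hg'
  have hdag : IsDAGdk k g' := by
    have hrank : ∀ u w, u ∈ g' w → Function.update r b (r a + 1) u <
        Function.update r b (r a + 1) w := by
      intro u w huw
      by_cases hw : w = b
      · subst hw
        simp only [hg', Function.update_self, Finset.mem_singleton] at huw
        subst huw
        simp [hab]
      · have hu : u ∈ g w := by simpa [hg', hw] using huw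
        have hwW : w ∈ Finset.univ.erase b := by simp [hw]
        have hub : u ≠ b := by simpa using (hg1 w hwW).2.2 hu
        simpa [hw, hub] using hr u w ⟨hwW, hu⟩
    refine ⟨fun i => ⟨fun hi => lt_irrefl _ (hrank i i hi), ?_⟩, acyclic_of_rank _ hrank⟩
    by_cases hi : i = b
    · subst hi; simpa [hg'] using hk
    · simpa [hg', hi] using (hg1 i (by simp [hi])).2.1
  have hle : score μ X g' ≤ Sstar k μ X := by
    refine le_csSup ?_ ⟨g', hdag, rfl⟩
    refine ((Set.finite_range (fun g => score μ X g)).subset ?_).bddAbove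
    rintro s ⟨g, _, rfl⟩
    exact ⟨g, rfl⟩
  have hsc : score μ X g' = scoreOn μ X (Finset.univ.erase b) g - famEnt μ X b {a} := by
    rw [score, scoreOn, ← Finset.add_sum_erase _ _ (Finset.mem_univ b)]
    rw [Finset.sum_congr rfl (g := fun i => famEnt μ X i (g i))
      (fun i hi => by simp [hg', Finset.ne_of_mem_erase hi])]
    simp [hg']
    ring
  linarith

theorem score_gap_of_noisy_children
    {d k : ℕ} {Ω α : Type*} [Fintype Ω] [Fintype α] [DecidableEq α]
    (hd : 1 ≤ d) (hk : 1 ≤ k)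
    (μ : Ω → ℝ) (hμ : IsPMF μ) (X : Fin d → Ω → α)
    (lam β : ℝ) (hlam : 0 < lam) (hβ : 0 < β)
    (a b : Fin d) (hab : a ≠ b) (hnc : NoisyCopy μ X a b lam)
    (hgap : ∀ g, IsDAGon k (Finset.univ.erase b) g →
      (∃ w ∈ Finset.univ.erase b, a ∈ g w) →
      scoreOn μ X (Finset.univ.erase b) g ≤ SstarOn k (Finset.univ.erase b) μ X - β)
    (G : Fin d → Finset (Fin d)) (hG : IsDAGdk k G)
    (hchild : ∃ w, w ≠ a ∧ w ≠ b ∧ (a ∈ G w ∨ b ∈ G w)) :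
    score μ X G < Sstar k μ X - β + 3 * d * lam := by
  obtain ⟨-, hba, hab'⟩ := hnc
  rw [condEnt_eq hμ] at hba hab'
  have hS := SstarOn_le hk μ X lam a b hab hba
  obtain ⟨hG1, hG2⟩ := hG
  obtain ⟨r, hr⟩ := exists_rank hG2
  obtain ⟨w, hwa, hwb, hw⟩ := hchild
  have hd' : (1 : ℝ) ≤ d := by exact_mod_cast hd
  -- the merged graph
  let M : Fin d → Finset (Fin d) := fun i => if b ∈ G i then insert a ((G i).erase b) else G i
  let g : Fin d → Finset (Fin d) := if r a ≤ r b then M else Function.update M a (G b)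
  have hMcard : ∀ i, (M i).card ≤ k := by
    intro i
    refine le_trans ?_ (hG1 i).2
    by_cases h : b ∈ G i
    · simp only [M, h, if_true]
      refine (Finset.card_insert_le _ _).trans ?_
      rw [Finset.card_erase_add_one h]
    · simp [M, h]
  have hMb : ∀ i, b ∉ M i := by
    intro i; simp only [M]; split_ifs with h <;> simp [h, hab.symm]
  have hMmem : ∀ i u, u ∈ M i → u ∈ G i ∨ (u = a ∧ b ∈ G i) := by
    intro i u; simp only [M]; split_ifs with h <;> grind
  have hMe : ∀ i, famEnt μ X i (M i) ≤ famEnt μ X i (G i) + lam := by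
    intro i
    by_cases h : b ∈ G i
    · simp only [M, h, if_true]
      exact famEnt_replace hμ X i a b hba _ h hab
    · simp only [M, h, if_false]; linarith
  have hMw : a ∈ M w := by
    simp only [M]; split_ifs with h
    · simp
    · tauto
  have hrest : ∀ i, i ≠ a → g i = M i := by
    intro i hi; simp only [g]; split_ifs
    · rfl
    · simp [hi]
  have hga : famEnt μ X a (g a) ≤ famEnt μ X a (G a) + famEnt μ X b (G b) + lam := by
    have n1 := famEnt_nonneg hμ X a (G a)
    have n2 := famEnt_nonneg hμ X b (G b)
    by_cases h : r a ≤ r b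
    · simp only [g, h, if_true]; linarith [hMe a]
    · simp only [g, h, if_false, Function.update_self]
      linarith [famEnt_child hμ X a b hab' (G b)]
  have hgb : ∀ i, b ∉ g i := by
    intro i
    by_cases h : i = a
    · subst h
      simp only [g]; split_ifs
      · exact hMb _
      · simpa using (hG1 b).1
    · rw [hrest i h]; exact hMb i
  have hgcard : ∀ i, (g i).card ≤ k := by
    intro i
    by_cases h : i = a
    · subst h
      simp only [g]; split_ifs
      · exact hMcard _
      · simpa using (hG1 b).2
    · rw [hrest i h]; exact hMcard i
  have hrank : ∃ f : Fin d → ℕ, ∀ u v, v ≠ b → u ∈ g v → f u < f v := by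
    by_cases h : r a ≤ r b
    · refine ⟨r, fun u v _ huv => ?_⟩
      simp only [g, h, if_true] at huv
      rcases hMmem _ _ huv with h1 | ⟨rfl, h1⟩
      · exact hr _ _ h1
      · exact h.trans_lt (hr _ _ h1)
    · refine ⟨Function.update r a (r b), fun u v _ huv => ?_⟩
      by_cases hv : v = a
      · subst hv
        simp only [g, h, if_false, Function.update_self] at huv
        have h1 := hr _ _ huv
        have hu : u ≠ v := by rintro rfl; omega
        simpa [hu] using h1
      · rw [hrest v hv] at huv
        rw [Function.update_of_ne hv]
        by_cases hu : u = a
        · subst hu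
          rw [Function.update_self]
          rcases hMmem _ _ huv with h1 | ⟨-, h1⟩
          · have := hr _ _ h1; omega
          · exact hr _ _ h1
        · rw [Function.update_of_ne hu]
          rcases hMmem _ _ huv with h1 | ⟨h2, -⟩
          · exact hr _ _ h1
          · exact absurd h2 hu
  obtain ⟨f, hf⟩ := hrank
  have hdag : IsDAGon k (Finset.univ.erase b) g := by
    refine ⟨fun i hi => ⟨fun h => lt_irrefl _ (hf i i (by simpa using hi) h), hgcard i, ?_⟩,
      acyclic_of_rank f fun u v h => hf u v (by simpa using h.1) h.2⟩
    intro u hu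
    simp only [Finset.mem_erase, Finset.mem_univ, and_true]
    rintro rfl
    exact hgb i hu
  have hgs := hgap g hdag ⟨w, by simp [hwb], by rw [hrest w hwa]; exact hMw⟩
  have haW : a ∈ Finset.univ.erase b := by simp [hab]
  have hsum : scoreOn μ X (Finset.univ.erase b) g ≥ score μ X G - d * lam := by
    rw [score, scoreOn, ← Finset.add_sum_erase _ _ (Finset.mem_univ b),
      ← Finset.add_sum_erase _ (fun i => famEnt μ X i (G i)) haW,
      ← Finset.add_sum_erase _ (fun i => famEnt μ X i (g i)) haW]
    have h1 : ∑ i ∈ (Finset.univ.erase b).erase a, famEnt μ X i (g i) ≤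
        ∑ i ∈ (Finset.univ.erase b).erase a, (famEnt μ X i (G i) + lam) :=
      Finset.sum_le_sum fun i hi => by
        rw [hrest i (Finset.ne_of_mem_erase hi)]; exact hMe i
    rw [Finset.sum_add_distrib, Finset.sum_const, nsmul_eq_mul] at h1
    have hc : (((Finset.univ.erase b).erase a).card : ℝ) + 1 ≤ d := by
      have e1 := Finset.card_erase_add_one haW
      have e2 := Finset.card_erase_le (s := (Finset.univ : Finset (Fin d))) (a := b)
      rw [Finset.card_univ, Fintype.card_fin] at e2
      exact_mod_cast e1.trans_le e2
    nlinarith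
  nlinarith
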